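/- The linear operator field L(x,y,z) = [[2x,y,0],[y,0,0],[0,0,z]] on ℝ³ is a Nijenhuis operator; the coefficients of its characteristic polynomial are σ₁ = −2x−z, σ₂ = −y²+2xz, σ₃ = y²z, and these three polynomials are algebraically independent over ℝ. Consequently the algebra 𝔟₄⁻⊕𝔡 with relations η₁⋆η₁ = 2η₁, η₁⋆η₂ = η₂, η₂⋆η₂ = η₁, η₃⋆η₃ = η₃ (other products zero) is a differentially non-degenerate LSA. -/

import Mathlib

open Matrix

/-- Components `N^i_{jk}` of the Nijenhuis torsion of a matrix-valued operator
field `L` on `ℝⁿ` (with `L x i j = L^i_j(x)`). -/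
noncomputable def nijTorsion {n : ℕ} (L : (Fin n → ℝ) → Matrix (Fin n) (Fin n) ℝ)
    (x : Fin n → ℝ) (i j k : Fin n) : ℝ :=
  ∑ s : Fin n,
    (L x s j * fderiv ℝ (fun y => L y i k) x (Pi.single s 1)
      - L x s k * fderiv ℝ (fun y => L y i j) x (Pi.single s 1)
      - L x i s * fderiv ℝ (fun y => L y s k) x (Pi.single j 1)
      + L x i s * fderiv ℝ (fun y => L y s j) x (Pi.single k 1))

/-- `L` is a Nijenhuis operator: its Nijenhuis torsion vanishes identically. -/
def IsNijenhuis {n : ℕ} (L : (Fin n → ℝ) → Matrix (Fin n) (Fin n) ℝ) : Prop :=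
  ∀ x i j k, nijTorsion L x i j k = 0

/-- Bilinear product on `ℝⁿ` with structure constants `a i j k`
(`ηᵢ ⋆ ηⱼ = ∑ₖ a i j k • ηₖ`). -/
def mulSC {n : ℕ} (a : Fin n → Fin n → Fin n → ℝ) (ξ η : Fin n → ℝ) : Fin n → ℝ :=
  fun k => ∑ i : Fin n, ∑ j : Fin n, a i j k * ξ i * η j

/-- Left-symmetry: the associator is symmetric in its first two arguments. -/
def IsLSA {n : ℕ} (a : Fin n → Fin n → Fin n → ℝ) : Prop :=
  ∀ ξ η ζ : Fin n → ℝ,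
    mulSC a (mulSC a ξ η) ζ - mulSC a ξ (mulSC a η ζ)
      = mulSC a (mulSC a η ξ) ζ - mulSC a η (mulSC a ξ ζ)

/-- The right-adjoint operator field of the algebra with structure constants `a`:
`(R x) k i = ∑ j, a i j k * x j`, i.e. `(R x).mulVec ξ = ξ ⋆ x`. -/
def rightAdj {n : ℕ} (a : Fin n → Fin n → Fin n → ℝ) (x : Fin n → ℝ) :
    Matrix (Fin n) (Fin n) ℝ :=
  Matrix.of fun k i => ∑ j : Fin n, a i j k * x j

/-- `charCoeff L i` is the coefficient `σ_{i+1}` of `t^(n-1-i)` in the characteristic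
polynomial `χ_{L(x)}(t) = tⁿ + σ₁(x) tⁿ⁻¹ + ⋯ + σₙ(x)` of `L(x)`. -/
noncomputable def charCoeff {n : ℕ} (L : (Fin n → ℝ) → Matrix (Fin n) (Fin n) ℝ)
    (i : Fin n) : (Fin n → ℝ) → ℝ :=
  fun x => (L x).charpoly.coeff (n - 1 - (i : ℕ))

/-- A (structure-constant) algebra is differentially non-degenerate if the coefficients
of the characteristic polynomial of its right-adjoint operator are algebraically
independent over `ℝ` (as elements of the algebra of real-valued functions). -/
def DiffNonDeg {n : ℕ} (a : Fin n → Fin n → Fin n → ℝ) : Prop :=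
  AlgebraicIndependent ℝ (charCoeff (rightAdj a))

/-- Isomorphism of the algebras on `ℝⁿ` with structure constants `a` and `b`. -/
def AlgIsoSC {n : ℕ} (a b : Fin n → Fin n → Fin n → ℝ) : Prop :=
  ∃ φ : (Fin n → ℝ) ≃ₗ[ℝ] (Fin n → ℝ),
    ∀ ξ η : Fin n → ℝ, φ (mulSC a ξ η) = mulSC b (φ ξ) (φ η)

/-- Jacobi matrix of a family of functions `σ` on `ℝⁿ`: `J i j = ∂σᵢ/∂xⱼ`. -/
noncomputable def jacobiMat {n : ℕ} (σ : Fin n → (Fin n → ℝ) → ℝ) (x : Fin n → ℝ) :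
    Matrix (Fin n) (Fin n) ℝ :=
  Matrix.of fun i j => fderiv ℝ (σ i) x (Pi.single j 1)

/-- Companion-type matrix with first column `(-s 0, …, -s (n-1))ᵀ`, ones on the
superdiagonal and zeros elsewhere. -/
def companionS {n : ℕ} (s : Fin n → ℝ) : Matrix (Fin n) (Fin n) ℝ :=
  Matrix.of fun i j => if (j : ℕ) = 0 then -s i else if (j : ℕ) = (i : ℕ) + 1 then 1 else 0

/-- The operator field of the 𝔟₄⁻⊕𝔡. -/
def Lop (x : Fin 3 → ℝ) : Matrix (Fin 3) (Fin 3) ℝ :=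
  Matrix.of ![![2 * x 0, x 1, 0], ![x 1, 0, 0], ![0, 0, x 2]]

/-- Structure constants of the 𝔟₄⁻⊕𝔡. -/
def sc : Fin 3 → Fin 3 → Fin 3 → ℝ :=
  ![![![2,0,0], ![0,1,0], ![0,0,0]],
    ![![0,0,0], ![1,0,0], ![0,0,0]],
    ![![0,0,0], ![0,0,0], ![0,0,1]]]

/-- The components of `Lop` depend linearly on the point, so each is its own derivative. -/
theorem fderiv_Lop_apply (i k : Fin 3) (x v : Fin 3 → ℝ) :
    fderiv ℝ (fun y => Lop y i k) x v = Lop v i k := by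
  let f : (Fin 3 → ℝ) →ₗ[ℝ] ℝ :=
    { toFun := fun y => Lop y i k
      map_add' := fun y z => by
        fin_cases i <;> fin_cases k <;> simp [Lop, mul_add]
      map_smul' := fun c y => by
        fin_cases i <;> fin_cases k <;> simp [Lop, mul_left_comm] }
  exact congrArg (fun g => g v) (LinearMap.toContinuousLinearMap f).fderiv

theorem isNijenhuis_Lop : IsNijenhuis Lop := by
  intro x i j k
  simp only [nijTorsion, fderiv_Lop_apply, Fin.sum_univ_three]
  fin_cases i <;> fin_cases j <;> fin_cases k <;> simp [Lop] <;> ring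

open Polynomial in
theorem charpoly_Lop (x : Fin 3 → ℝ) :
    (Lop x).charpoly = X ^ 3 + C (-2 * x 0 - x 2) * X ^ 2
      + C (-(x 1 ^ 2) + 2 * x 0 * x 2) * X + C (x 1 ^ 2 * x 2) := by
  rw [Matrix.charpoly, Matrix.det_fin_three]
  simp [Lop]
  ring

theorem charCoeff_Lop :
    charCoeff Lop =
      ![(fun x : Fin 3 → ℝ => -2 * x 0 - x 2),
        (fun x : Fin 3 → ℝ => -(x 1 ^ 2) + 2 * x 0 * x 2),
        (fun x : Fin 3 → ℝ => x 1 ^ 2 * x 2)] := by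
  funext i x
  simp only [charCoeff, charpoly_Lop, Polynomial.coeff_add, Polynomial.coeff_C_mul,
    Polynomial.coeff_X_pow, Polynomial.coeff_X, Polynomial.coeff_C]
  fin_cases i <;> simp

/-- Functions on a set are algebraically independent as soon as their joint image contains a
product of infinite sets. -/
theorem algebraicIndependent_of_pi_subset_range {ι X R : Type*} [CommRing R] [IsDomain R]
    (f : ι → X → R) (s : ι → Set R) (hs : ∀ i, (s i).Infinite)
    (h : Set.univ.pi s ⊆ Set.range fun x i => f i x) : AlgebraicIndependent R f := by
  rw [algebraicIndependent_iff]
  intro p hp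
  refine MvPolynomial.funext_set s hs fun t ht => ?_
  obtain ⟨x, rfl⟩ := h ht
  have hx := congrArg (Pi.evalAlgHom R (fun _ : X => R) x) hp
  rw [MvPolynomial.comp_aeval_apply] at hx
  simpa [MvPolynomial.aeval_eq_eval] using hx

/-- Every `(a, b, c)` with `a < -3`, `b < 1`, `0 < c < 1` is a value of the coefficients of the
characteristic polynomial: `t ^ 3 + a t ^ 2 + b t + c` has a root in `(0, 1)`. -/
theorem exists_charCoeff_Lop_eq {a b c : ℝ} (ha : a < -3) (hb : b < 1) (hc₀ : 0 < c)
    (hc₁ : c < 1) :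
    ∃ x y z : ℝ, -2 * x - z = a ∧ -(y ^ 2) + 2 * x * z = b ∧ y ^ 2 * z = c := by
  have hcont : ContinuousOn (fun t : ℝ => t ^ 3 + a * t ^ 2 + b * t + c) (Set.Icc 0 1) := by
    fun_prop
  obtain ⟨z, hz, hroot⟩ := intermediate_value_Icc' zero_le_one hcont
    (show (0 : ℝ) ∈ Set.Icc _ _ from ⟨by norm_num; linarith, by norm_num; linarith⟩)
  have hz₀ : z ≠ 0 := by
    rintro rfl
    norm_num at hroot
    exact hc₀.ne' hroot
  have hy : √(c / z) ^ 2 = c / z := Real.sq_sqrt (div_nonneg hc₀.le hz.1)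
  refine ⟨(-a - z) / 2, √(c / z), z, by ring, ?_, ?_⟩
  · rw [hy]
    field_simp
    linear_combination -hroot
  · rw [hy, div_mul_cancel₀ c hz₀]

theorem algebraicIndependent_charCoeff_Lop : AlgebraicIndependent ℝ (charCoeff Lop) := by
  rw [charCoeff_Lop]
  refine algebraicIndependent_of_pi_subset_range _
    ![Set.Iio (-3), Set.Iio 1, Set.Ioo 0 1] ?_ ?_
  · intro i
    fin_cases i
    · exact Set.Iio_infinite _
    · exact Set.Iio_infinite _
    · exact Set.Ioo_infinite zero_lt_one
  · intro t ht
    obtain ⟨x, y, z, h₀, h₁, h₂⟩ := exists_charCoeff_Lop_eq (ht 0 trivial) (ht 1 trivial)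
      (ht 2 trivial).1 (ht 2 trivial).2
    refine ⟨![x, y, z], funext fun i => ?_⟩
    fin_cases i
    · exact h₀
    · exact h₁
    · exact h₂

theorem rightAdj_sc : rightAdj sc = Lop := by
  funext x
  ext k i
  fin_cases k <;> fin_cases i <;> simp [rightAdj, sc, Lop, Fin.sum_univ_three]

theorem isLSA_sc : IsLSA sc := by
  intro ξ η ζ
  funext k
  fin_cases k <;> simp [mulSC, sc, Fin.sum_univ_three] <;> ring

/-- The operator field is a Nijenhuis operator; the coefficients of its
characteristic polynomial are the stated polynomials, which are algebraically
independent over `ℝ`; it is the right-adjoint operator of the stated algebra,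
which is consequently a differentially non-degenerate LSA. -/
theorem stmt9 :
    IsNijenhuis Lop ∧
    (∀ x : Fin 3 → ℝ, charCoeff Lop 0 x = -2 * x 0 - x 2) ∧
    (∀ x : Fin 3 → ℝ, charCoeff Lop 1 x = -(x 1 ^ 2) + 2 * x 0 * x 2) ∧
    (∀ x : Fin 3 → ℝ, charCoeff Lop 2 x = x 1 ^ 2 * x 2) ∧
    AlgebraicIndependent ℝ
      ![(fun x : Fin 3 → ℝ => -2 * x 0 - x 2),
        (fun x : Fin 3 → ℝ => -(x 1 ^ 2) + 2 * x 0 * x 2),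
        (fun x : Fin 3 → ℝ => x 1 ^ 2 * x 2)] ∧
    rightAdj sc = Lop ∧ IsLSA sc ∧ DiffNonDeg sc := by
  exact ⟨isNijenhuis_Lop, fun x => congrFun (congrFun charCoeff_Lop 0) x,
    fun x => congrFun (congrFun charCoeff_Lop 1) x, fun x => congrFun (congrFun charCoeff_Lop 2) x,
    charCoeff_Lop ▸ algebraicIndependent_charCoeff_Lop, rightAdj_sc, isLSA_sc,
    show AlgebraicIndependent ℝ (charCoeff (rightAdj sc)) from
      rightAdj_sc.symm ▸ algebraicIndependent_charCoeff_Lop⟩
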